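/- arXiv:1411.6156 — 2 statements merged into one kernel-verified Lean document; each statement's English description precedes it below -/
import Mathlib

section
/- Let u ∈ V, let S ⊆ V∖{u} with U := ∂u∖S nonempty. Then for every configuration x_S ∈ {−1,+1}^S with P(X_S = x_S) > 0, the signed weighted influences satisfy Σ_{i∈U} θ_{ui}·λ_i(x_S)·ν_{u|i;x_S} ≥ 2τ*·Σ_{i∈U} |θ_{ui}|, where τ* = α²·δ^{4d+1}/(16dβ). -/
noncomputable section

open Real Finset

/-- The spin value (±1) associated to a Boolean. -/
def spin (b : Bool) : ℝ := if b then 1 else -1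

/-- The energy (Hamiltonian, without normalization) of a configuration of the Ising model:
`Σ_{{i,j}∈E} θ_{ij} x_i x_j + Σ_{i∈V} θ_i x_i`, where the sum over edges is written as half the
sum over ordered adjacent pairs (the edge couplings are symmetric). -/
def energy {p : ℕ} (G : SimpleGraph (Fin p)) [DecidableRel G.Adj]
    (θe : Fin p → Fin p → ℝ) (θv : Fin p → ℝ) (x : Fin p → Bool) : ℝ :=
  (∑ i, ∑ j, if G.Adj i j then θe i j * spin (x i) * spin (x j) else 0) / 2
    + ∑ i, θv i * spin (x i)

/-- The Ising model probability mass function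
`P(x) = exp(Σ_{{i,j}∈E} θ_{ij} x_i x_j + Σ_{i∈V} θ_i x_i − Φ(θ))`. -/
def isingPMF {p : ℕ} (G : SimpleGraph (Fin p)) [DecidableRel G.Adj]
    (θe : Fin p → Fin p → ℝ) (θv : Fin p → ℝ) (x : Fin p → Bool) : ℝ :=
  Real.exp (energy G θe θv x) / ∑ y : Fin p → Bool, Real.exp (energy G θe θv y)

open Classical in
/-- Probability of an event under a pmf on configurations. -/
def prob {p : ℕ} (μ : (Fin p → Bool) → ℝ) (A : (Fin p → Bool) → Prop) : ℝ :=
  ∑ x : Fin p → Bool, if A x then μ x else 0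

/-- Conditional probability `P(A | B)`. -/
def condProb {p : ℕ} (μ : (Fin p → Bool) → ℝ) (A B : (Fin p → Bool) → Prop) : ℝ :=
  prob μ (fun x => A x ∧ B x) / prob μ B

open Classical in
/-- Conditional expectation `E[f(X) | B]`. -/
def condExp {p : ℕ} (μ : (Fin p → Bool) → ℝ) (B : (Fin p → Bool) → Prop)
    (f : (Fin p → Bool) → ℝ) : ℝ :=
  (∑ x : Fin p → Bool, if B x then μ x * f x else 0) / prob μ B

/-- The event `X_S = σ_S` (agreement with `σ` on the set `S`). -/
def agree {p : ℕ} (S : Finset (Fin p)) (σ : Fin p → Bool) (x : Fin p → Bool) : Prop :=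
  ∀ i ∈ S, x i = σ i

/-- The conditional influence
`ν_{u|i;x_S} = P(X_u=+1 | X_i=+1, X_S=x_S) − P(X_u=+1 | X_i=−1, X_S=x_S)`. -/
def condInf {p : ℕ} (μ : (Fin p → Bool) → ℝ) (u i : Fin p) (S : Finset (Fin p))
    (σ : Fin p → Bool) : ℝ :=
  condProb μ (fun x => x u = true) (fun x => x i = true ∧ agree S σ x)
    - condProb μ (fun x => x u = true) (fun x => x i = false ∧ agree S σ x)

/-- The weight `λ_i(x_S) = 2·P(X_i=+1|X_S=x_S)·P(X_i=−1|X_S=x_S)`. -/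
def lamWeight {p : ℕ} (μ : (Fin p → Bool) → ℝ) (i : Fin p) (S : Finset (Fin p))
    (σ : Fin p → Bool) : ℝ :=
  2 * condProb μ (fun x => x i = true) (agree S σ)
    * condProb μ (fun x => x i = false) (agree S σ)

/-- The average conditional influence `ν̄(u,i,S) = E[λ_i(X_S)·|ν_{u|i;X_S}|]`, the expectation
over `X_S` with law the marginal of `μ` on `S` (the integrand depends on the configuration only
through its restriction to `S`). -/
def avgInf {p : ℕ} (μ : (Fin p → Bool) → ℝ) (u i : Fin p) (S : Finset (Fin p)) : ℝ :=
  ∑ x : Fin p → Bool, μ x * (lamWeight μ i S x * |condInf μ u i S x|)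

/-- `δ = (1/2)·e^{−2(βd+h)}`. -/
def deltaLB (β h : ℝ) (d : ℕ) : ℝ := (1/2) * Real.exp (-(2 * (β * d + h)))

/-- `τ* = α²·δ^{4d+1}/(16dβ)`. -/
def tauStar (α β h : ℝ) (d : ℕ) : ℝ :=
  α ^ 2 * (deltaLB β h d) ^ (4 * d + 1) / (16 * d * β)

/-- The conditional mutual information `I(X_u ; X_i | X_S)`, computed with natural logarithms,
written as the expectation of the log-likelihood ratio
`log( P(X_u,X_i,X_S)·P(X_S) / (P(X_u,X_S)·P(X_i,X_S)) )`. -/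
def condMI {p : ℕ} (μ : (Fin p → Bool) → ℝ) (u i : Fin p) (S : Finset (Fin p)) : ℝ :=
  ∑ x : Fin p → Bool, μ x * Real.log
    ((prob μ (fun z => z u = x u ∧ z i = x i ∧ agree S x z) * prob μ (agree S x))
      / (prob μ (fun z => z u = x u ∧ agree S x z)
          * prob μ (fun z => z i = x i ∧ agree S x z)))

/-- The configuration obtained from `x` by reversing the spin at `v`. -/
def flipAt {p : ℕ} (v : Fin p) (x : Fin p → Bool) : Fin p → Bool :=
  Function.update x v (!x v)

/-- The effective field at `v` exerted by its neighbours and the external field. -/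
def localField {p : ℕ} (θe : Fin p → Fin p → ℝ) (θv : Fin p → ℝ) (v : Fin p)
    (x : Fin p → Bool) : ℝ :=
  θv v + ∑ j, θe v j * spin (x j)

open Classical in
/-- The law `μ` conditioned on `X_S = σ_S`. -/
def condLaw {p : ℕ} (μ : (Fin p → Bool) → ℝ) (S : Finset (Fin p)) (σ x : Fin p → Bool) : ℝ :=
  if agree S σ x then μ x / prob μ (agree S σ) else 0

theorem flipAt_involutive {p : ℕ} (v : Fin p) : Function.Involutive (flipAt v) := by
  intro x
  simp [flipAt]

theorem sum_comp_flipAt {p : ℕ} (v : Fin p) (f : (Fin p → Bool) → ℝ) :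
    ∑ x, f (flipAt v x) = ∑ x, f x :=
  Equiv.sum_comp (flipAt_involutive v).toPerm f

theorem flipAt_of_ne {p : ℕ} {v j : Fin p} (hj : j ≠ v) (x : Fin p → Bool) :
    flipAt v x j = x j := by
  simp [flipAt, hj]

theorem spin_not (b : Bool) : spin (!b) = -spin b := by
  cases b <;> simp [spin]

theorem abs_spin (b : Bool) : |spin b| = 1 := by
  cases b <;> simp [spin]

theorem spin_flipAt {p : ℕ} (v i : Fin p) (x : Fin p → Bool) :
    spin (flipAt v x i) = spin (x i) - if i = v then 2 * spin (x v) else 0 := by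
  by_cases hi : i = v
  · subst hi
    simp only [flipAt, Function.update_self, spin_not, if_true]
    ring
  · simp [flipAt_of_ne hi, hi]

theorem agree_flipAt_iff {p : ℕ} {S : Finset (Fin p)} {v : Fin p} (hv : v ∉ S)
    (σ x : Fin p → Bool) : agree S σ (flipAt v x) ↔ agree S σ x := by
  refine forall₂_congr fun i hi => ?_
  rw [flipAt_of_ne (ne_of_mem_of_not_mem hi hv)]

theorem localField_flipAt {p : ℕ} {θe : Fin p → Fin p → ℝ} {v : Fin p} (hvv : θe v v = 0)
    (θv : Fin p → ℝ) (x : Fin p → Bool) :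
    localField θe θv v (flipAt v x) = localField θe θv v x := by
  unfold localField
  congr 1
  refine sum_congr rfl fun j _ => ?_
  by_cases hj : j = v
  · simp [hj, hvv]
  · rw [flipAt_of_ne hj]

theorem energy_eq_of_nonedge {p : ℕ} (G : SimpleGraph (Fin p)) [DecidableRel G.Adj]
    {θe : Fin p → Fin p → ℝ} (hnonedge : ∀ i j, ¬ G.Adj i j → θe i j = 0)
    (θv : Fin p → ℝ) (x : Fin p → Bool) :
    energy G θe θv x
      = (∑ i, ∑ j, θe i j * spin (x i) * spin (x j)) / 2 + ∑ i, θv i * spin (x i) := by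
  unfold energy
  congr 2
  refine sum_congr rfl fun i _ => sum_congr rfl fun j _ => ?_
  split_ifs with hij
  · rfl
  · simp [hnonedge i j hij]

theorem energy_sub_energy_flipAt {p : ℕ} (G : SimpleGraph (Fin p)) [DecidableRel G.Adj]
    {θe : Fin p → Fin p → ℝ} (hsym : ∀ i j, θe i j = θe j i)
    (hnonedge : ∀ i j, ¬ G.Adj i j → θe i j = 0)
    (θv : Fin p → ℝ) (v : Fin p) (x : Fin p → Bool) :
    energy G θe θv x - energy G θe θv (flipAt v x)
      = 2 * localField θe θv v x * spin (x v) := by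
  rw [energy_eq_of_nonedge G hnonedge, energy_eq_of_nonedge G hnonedge]
  have hvv : θe v v = 0 := hnonedge v v (G.loopless.irrefl v)
  have hlin : ∑ i, θv i * spin (flipAt v x i)
      = ∑ i, θv i * spin (x i) - 2 * θv v * spin (x v) := by
    simp only [spin_flipAt, mul_sub, sum_sub_distrib, mul_ite, mul_zero,
      sum_ite_eq', mem_univ, if_true]
    ring
  have hquad : ∑ i, ∑ j, θe i j * spin (flipAt v x i) * spin (flipAt v x j)
      = ∑ i, ∑ j, θe i j * spin (x i) * spin (x j)
        - 4 * spin (x v) * ∑ j, θe v j * spin (x j) := by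
    have hterm : ∀ i j, θe i j * spin (flipAt v x i) * spin (flipAt v x j)
        = θe i j * spin (x i) * spin (x j)
          - (if i = v then 2 * spin (x v) * (θe v j * spin (x j)) else 0)
          - (if j = v then 2 * spin (x v) * (θe v i * spin (x i)) else 0) := by
      intro i j
      rw [spin_flipAt, spin_flipAt]
      by_cases hi : i = v <;> by_cases hj : j = v
      · subst hi; subst hj; simp [hvv]
      · subst hi; simp [hj]; ring
      · subst hj; simp [hi, hsym i j]; ring
      · simp [hi, hj]
    simp only [hterm, sum_sub_distrib, sum_ite_eq', mem_univ, if_true]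
    rw [sum_comm (f := fun i j => if i = v then 2 * spin (x v) * (θe v j * spin (x j)) else 0)]
    simp only [sum_ite_eq', mem_univ, if_true, ← mul_sum]
    ring
  rw [hlin, hquad]
  unfold localField
  ring

theorem abs_localField_le {p d : ℕ} (G : SimpleGraph (Fin p)) [DecidableRel G.Adj]
    {θe : Fin p → Fin p → ℝ} {θv : Fin p → ℝ} {β h : ℝ} (hβ : 0 ≤ β) {v : Fin p}
    (hdeg : G.degree v ≤ d) (hedge : ∀ j, G.Adj v j → |θe v j| ≤ β)
    (hnonedge : ∀ j, ¬ G.Adj v j → θe v j = 0) (hfield : |θv v| ≤ h) (x : Fin p → Bool) :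
    |localField θe θv v x| ≤ β * d + h := by
  have hsum : |∑ j, θe v j * spin (x j)| ≤ β * d := by
    calc |∑ j, θe v j * spin (x j)| ≤ ∑ j, |θe v j| := by
          refine (abs_sum_le_sum_abs _ _).trans_eq (sum_congr rfl fun j _ => ?_)
          rw [abs_mul, abs_spin, mul_one]
      _ = ∑ j ∈ G.neighborFinset v, |θe v j| := by
          refine (sum_subset (subset_univ _) fun j _ hj => ?_).symm
          rw [hnonedge j (by simpa using hj), abs_zero]
      _ ≤ (G.neighborFinset v).card • β :=
          sum_le_card_nsmul _ _ _ fun j hj => hedge j (by simpa using hj)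
      _ ≤ β * d := by
          rw [G.card_neighborFinset_eq_degree, nsmul_eq_mul, mul_comm]
          gcongr
  calc |localField θe θv v x| ≤ |θv v| + |∑ j, θe v j * spin (x j)| := abs_add_le _ _
    _ ≤ β * d + h := by linarith

theorem isingPMF_pos {p : ℕ} (G : SimpleGraph (Fin p)) [DecidableRel G.Adj]
    (θe : Fin p → Fin p → ℝ) (θv : Fin p → ℝ) (x : Fin p → Bool) : 0 < isingPMF G θe θv x :=
  div_pos (exp_pos _) (sum_pos (fun _ _ => exp_pos _) univ_nonempty)

theorem isingPMF_eq_exp_mul_flipAt {p : ℕ} (G : SimpleGraph (Fin p)) [DecidableRel G.Adj]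
    {θe : Fin p → Fin p → ℝ} (hsym : ∀ i j, θe i j = θe j i)
    (hnonedge : ∀ i j, ¬ G.Adj i j → θe i j = 0)
    (θv : Fin p → ℝ) (v : Fin p) (x : Fin p → Bool) :
    isingPMF G θe θv x
      = exp (2 * localField θe θv v x * spin (x v)) * isingPMF G θe θv (flipAt v x) := by
  unfold isingPMF
  rw [← energy_sub_energy_flipAt G hsym hnonedge, ← mul_div_assoc, ← exp_add, sub_add_cancel]

theorem condLaw_nonneg {p : ℕ} {μ : (Fin p → Bool) → ℝ} (hμ : ∀ x, 0 ≤ μ x)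
    (S : Finset (Fin p)) (σ x : Fin p → Bool) : 0 ≤ condLaw μ S σ x := by
  unfold condLaw
  split_ifs
  · exact div_nonneg (hμ x) (sum_nonneg fun y _ => by split_ifs <;> simp [hμ])
  · rfl

theorem sum_condLaw_mul_indicator {p : ℕ} (μ : (Fin p → Bool) → ℝ) (S : Finset (Fin p))
    (σ : Fin p → Bool) (A : (Fin p → Bool) → Prop) [DecidablePred A] :
    ∑ x, condLaw μ S σ x * (if A x then 1 else 0) = condProb μ A (agree S σ) := by
  unfold condProb
  rw [prob, sum_div]
  refine sum_congr rfl fun x _ => ?_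
  by_cases hA : A x <;> by_cases hS : agree S σ x <;> simp [condLaw, hA, hS]

theorem sum_condLaw {p : ℕ} {μ : (Fin p → Bool) → ℝ} {S : Finset (Fin p)} {σ : Fin p → Bool}
    (hpos : 0 < prob μ (agree S σ)) : ∑ x, condLaw μ S σ x = 1 := by
  have := sum_condLaw_mul_indicator μ S σ (fun _ => True)
  simpa [condProb, hpos.ne'] using this

theorem condLaw_eq_exp_mul_flipAt {p : ℕ} (G : SimpleGraph (Fin p)) [DecidableRel G.Adj]
    {θe : Fin p → Fin p → ℝ} (hsym : ∀ i j, θe i j = θe j i)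
    (hnonedge : ∀ i j, ¬ G.Adj i j → θe i j = 0)
    (θv : Fin p → ℝ) {S : Finset (Fin p)} {v : Fin p} (hv : v ∉ S) (σ x : Fin p → Bool) :
    condLaw (isingPMF G θe θv) S σ x
      = exp (2 * localField θe θv v x * spin (x v))
        * condLaw (isingPMF G θe θv) S σ (flipAt v x) := by
  have hiff := agree_flipAt_iff hv σ x
  unfold condLaw
  by_cases hx : agree S σ x
  · rw [if_pos hx, if_pos (hiff.2 hx), isingPMF_eq_exp_mul_flipAt G hsym hnonedge θv v x,
      mul_div_assoc]
  · rw [if_neg hx, if_neg (hiff.not.2 hx), mul_zero]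

theorem prob_and_add_prob_and_not {p : ℕ} (μ : (Fin p → Bool) → ℝ)
    (i : Fin p) (A B : (Fin p → Bool) → Prop) :
    prob μ (fun x => A x ∧ x i = true ∧ B x) + prob μ (fun x => A x ∧ x i = false ∧ B x)
      = prob μ (fun x => A x ∧ B x) := by
  unfold prob
  rw [← sum_add_distrib]
  refine sum_congr rfl fun x _ => ?_
  by_cases hA : A x <;> by_cases hB : B x <;> cases hx : x i <;> simp [hA, hB, hx]

theorem lamWeight_mul_condInf {p : ℕ} {μ : (Fin p → Bool) → ℝ} (hμ : ∀ x, 0 < μ x)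
    {S : Finset (Fin p)} {σ : Fin p → Bool} (hpos : 0 < prob μ (agree S σ))
    (u : Fin p) {i : Fin p} (hi : i ∉ S) :
    lamWeight μ i S σ * condInf μ u i S σ
      = (∑ x, condLaw μ S σ x * (spin (x u) * spin (x i))
          - (∑ x, condLaw μ S σ x * spin (x u)) * ∑ x, condLaw μ S σ x * spin (x i)) / 2 := by
  have hmass := sum_condLaw hpos
  have hone : ∀ j, ∑ x, condLaw μ S σ x * spin (x j)
      = 2 * condProb μ (fun x => x j = true) (agree S σ) - 1 := by
    intro j
    have hterm : ∀ x, condLaw μ S σ x * spin (x j)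
        = 2 * (condLaw μ S σ x * (if x j = true then 1 else 0)) - condLaw μ S σ x := by
      intro x
      cases x j <;> simp [spin]
      ring
    simp only [hterm, sum_sub_distrib, ← mul_sum, hmass, sum_condLaw_mul_indicator]
  have htwo : ∑ x, condLaw μ S σ x * (spin (x u) * spin (x i))
      = 4 * condProb μ (fun x => x u = true ∧ x i = true) (agree S σ)
        - 2 * condProb μ (fun x => x u = true) (agree S σ)
        - 2 * condProb μ (fun x => x i = true) (agree S σ) + 1 := by
    have hterm : ∀ x, condLaw μ S σ x * (spin (x u) * spin (x i))
        = 4 * (condLaw μ S σ x * (if x u = true ∧ x i = true then 1 else 0))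
          - 2 * (condLaw μ S σ x * (if x u = true then 1 else 0))
          - 2 * (condLaw μ S σ x * (if x i = true then 1 else 0)) + condLaw μ S σ x := by
      intro x
      cases x u <;> cases x i <;> simp [spin] <;> ring
    simp only [hterm, sum_sub_distrib, sum_add_distrib, ← mul_sum, hmass,
      sum_condLaw_mul_indicator]
  have hcond : ∀ b, 0 < prob μ (fun x => x i = b ∧ agree S σ x) := by
    intro b
    refine sum_pos' (fun x _ => ?_) ⟨Function.update σ i b, mem_univ _, ?_⟩
    · split_ifs
      exacts [(hμ x).le, le_rfl]
    · rw [if_pos]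
      · exact hμ _
      · refine ⟨Function.update_self .., fun j hj => ?_⟩
        exact Function.update_of_ne (ne_of_mem_of_not_mem hj hi) _ _
  have ha := hcond true
  have hb := hcond false
  have hab := prob_and_add_prob_and_not μ i (fun _ => True) (agree S σ)
  have hef := prob_and_add_prob_and_not μ i (fun x => x u = true) (agree S σ)
  simp only [true_and] at hab
  rw [htwo, hone, hone]
  unfold lamWeight condInf condProb
  simp only [and_assoc]
  rw [← hef]
  change prob μ (fun x => x i = true ∧ agree S σ x)
    + prob μ (fun x => x i = false ∧ agree S σ x) = prob μ (agree S σ) at hab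
  rw [← hab] at hpos ⊢
  have ha' := ha.ne'
  have hb' := hb.ne'
  have hab' := hpos.ne'
  field_simp
  ring

theorem mul_sub_sq_le_tanh_sub_mul_sub {a b M : ℝ} (ha : |a| ≤ M) (hb : |b| ≤ M) :
    exp (-(2 * M)) * (a - b) ^ 2 ≤ (tanh a - tanh b) * (a - b) := by
  have hcosh : ∀ t : ℝ, |t| ≤ M → cosh t ≤ exp M := by
    intro t ht
    rw [← cosh_abs, cosh_eq]
    have h1 := exp_le_exp.2 ht
    have h2 := exp_le_exp.2 (show -|t| ≤ M by linarith [abs_nonneg t])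
    linarith
  have hca := cosh_pos a
  have hcb := cosh_pos b
  have hsub : tanh a - tanh b = sinh (a - b) / (cosh a * cosh b) := by
    rw [tanh_eq_sinh_div_cosh, tanh_eq_sinh_div_cosh, sinh_sub]
    field_simp
  have hsinh : (a - b) ^ 2 ≤ sinh (a - b) * (a - b) := by
    rcases le_total 0 (a - b) with h0 | h0
    · nlinarith [self_le_sinh_iff.2 h0]
    · nlinarith [sinh_le_self_iff.2 h0]
  have hprod : cosh a * cosh b ≤ exp (2 * M) := by
    rw [two_mul, exp_add]
    exact mul_le_mul (hcosh a ha) (hcosh b hb) hcb.le (exp_pos _).le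
  rw [hsub, exp_neg, div_mul_eq_mul_div, inv_mul_eq_div]
  exact div_le_div₀ ((sq_nonneg _).trans hsinh) hsinh (by positivity) hprod

theorem exp_mul_spin_sub_tanh (m : ℝ) (b : Bool) :
    exp (2 * m * spin b) * (spin b - tanh m) = spin b + tanh m := by
  have h1 := exp_pos m
  cases b
  · simp only [spin, Bool.false_eq_true, if_false, tanh_eq, show 2 * m * -1 = -m + -m by ring,
      exp_add, exp_neg]
    field_simp
    ring
  · simp only [spin, if_true, tanh_eq, show 2 * m * 1 = m + m by ring, exp_add, exp_neg]
    field_simp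
    ring

/-- Under the conditional law, the spin at `u ∉ S` may be replaced by its conditional mean given
all other spins. -/
theorem sum_condLaw_spin_mul_eq_tanh {p : ℕ} (G : SimpleGraph (Fin p)) [DecidableRel G.Adj]
    {θe : Fin p → Fin p → ℝ} (hsym : ∀ i j, θe i j = θe j i)
    (hnonedge : ∀ i j, ¬ G.Adj i j → θe i j = 0)
    (θv : Fin p → ℝ) {S : Finset (Fin p)} {u : Fin p} (hu : u ∉ S) (σ : Fin p → Bool)
    {f : (Fin p → Bool) → ℝ} (hf : ∀ x, f (flipAt u x) = f x) :
    ∑ x, condLaw (isingPMF G θe θv) S σ x * (spin (x u) * f x)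
      = ∑ x, condLaw (isingPMF G θe θv) S σ x * (tanh (localField θe θv u x) * f x) := by
  set ρ := condLaw (isingPMF G θe θv) S σ with hρ
  have huu : θe u u = 0 := hnonedge u u (G.loopless.irrefl u)
  have hanti : ∀ x, ρ (flipAt u x)
        * ((spin (flipAt u x u) - tanh (localField θe θv u (flipAt u x))) * f (flipAt u x))
      = -(ρ x * ((spin (x u) - tanh (localField θe θv u x)) * f x)) := by
    intro x
    have hspin : spin (flipAt u x u) = -spin (x u) := by simp [flipAt, spin_not]
    rw [hf, localField_flipAt huu, hspin, hρ,
      condLaw_eq_exp_mul_flipAt G hsym hnonedge θv hu σ x]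
    linear_combination condLaw (isingPMF G θe θv) S σ (flipAt u x) * f x
      * exp_mul_spin_sub_tanh (localField θe θv u x) (x u)
  have hsum := sum_comp_flipAt u
    fun x => ρ x * ((spin (x u) - tanh (localField θe θv u x)) * f x)
  simp only [hanti, sum_neg_distrib] at hsum
  rw [← sub_eq_zero, ← sum_sub_distrib]
  simp only [← mul_sub, ← sub_mul]
  linarith

/-- A linear statistic of the spins fluctuates under the conditional law because each spin
outside `S` does. -/
theorem exp_mul_sq_le_sum_condLaw_mul_sq {p : ℕ} (G : SimpleGraph (Fin p)) [DecidableRel G.Adj]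
    {θe : Fin p → Fin p → ℝ} (hsym : ∀ i j, θe i j = θe j i)
    (hnonedge : ∀ i j, ¬ G.Adj i j → θe i j = 0)
    (θv : Fin p → ℝ) {S : Finset (Fin p)} {k : Fin p} (hk : k ∉ S) {σ : Fin p → Bool}
    (hpos : 0 < prob (isingPMF G θe θv) (agree S σ)) {M : ℝ}
    (hM : ∀ x, |localField θe θv k x| ≤ M) {f : (Fin p → Bool) → ℝ} {t : ℝ}
    (hf : ∀ x, f (flipAt k x) = f x - 2 * t * spin (x k)) :
    exp (-(2 * M)) * t ^ 2 ≤ ∑ x, condLaw (isingPMF G θe θv) S σ x * f x ^ 2 := by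
  set ρ := condLaw (isingPMF G θe θv) S σ with hρ
  have hρ0 : ∀ x, 0 ≤ ρ x := condLaw_nonneg (fun x => (isingPMF_pos G θe θv x).le) S σ
  have hle : ∀ x, exp (-(2 * M)) * ρ x ≤ ρ (flipAt k x) := by
    intro x
    rw [hρ, condLaw_eq_exp_mul_flipAt G hsym hnonedge θv hk σ x, ← mul_assoc, ← exp_add]
    refine mul_le_of_le_one_left (hρ0 _) (exp_le_one_iff.2 ?_)
    have := le_abs_self (localField θe θv k x * spin (x k))
    rw [abs_mul, abs_spin, mul_one] at this
    linarith [hM x]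
  have hM0 : 0 ≤ M := (abs_nonneg _).trans (hM σ)
  have hexp : exp (-(2 * M)) ≤ 1 := exp_le_one_iff.2 (by linarith)
  have hpair : ∀ x, 2 * (exp (-(2 * M)) * t ^ 2) * ρ x
      ≤ ρ x * f x ^ 2 + ρ (flipAt k x) * f (flipAt k x) ^ 2 := by
    intro x
    have hsq : spin (x k) ^ 2 = 1 := by rw [← sq_abs, abs_spin, one_pow]
    have hdiff : 2 * t ^ 2 ≤ f x ^ 2 + f (flipAt k x) ^ 2 := by
      rw [hf]
      nlinarith [sq_nonneg (f x - t * spin (x k))]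
    have h1 : exp (-(2 * M)) * ρ x ≤ ρ x := mul_le_of_le_one_left (hρ0 x) hexp
    have h2 := mul_le_mul_of_nonneg_right h1 (sq_nonneg (f x))
    have h3 := mul_le_mul_of_nonneg_right (hle x) (sq_nonneg (f (flipAt k x)))
    have h4 := mul_le_mul_of_nonneg_left hdiff (mul_nonneg (exp_pos (-(2 * M))).le (hρ0 x))
    linarith
  have hsum := sum_le_sum fun x (_ : x ∈ univ) => hpair x
  rw [sum_add_distrib, sum_comp_flipAt k (fun x => ρ x * f x ^ 2), ← mul_sum, hρ,
    sum_condLaw hpos] at hsum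
  linarith

theorem deltaLB_pow_le {β h : ℝ} {d : ℕ} (hβ : 0 ≤ β) (hh : 0 ≤ h) (hd : 1 ≤ d) :
    deltaLB β h d ^ (4 * d + 1) ≤ deltaLB β h d ^ 2 := by
  have hexp : exp (-(2 * (β * d + h))) ≤ 1 := exp_le_one_iff.2 (by
    have : 0 ≤ β * d := by positivity
    linarith)
  have hle : deltaLB β h d ≤ 1 := by
    unfold deltaLB
    linarith
  exact pow_le_pow_of_le_one (mul_nonneg (by norm_num) (exp_pos _).le) hle (by omega)

/-- The covariance, under the conditional law, of the spin at `u` and the random part of its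
local field is bounded below. -/
theorem le_sum_condLaw_spin_mul_centered {p : ℕ} (G : SimpleGraph (Fin p)) [DecidableRel G.Adj]
    {θe : Fin p → Fin p → ℝ} {θv : Fin p → ℝ} {α M : ℝ} (hα : 0 ≤ α)
    (hsym : ∀ i j, θe i j = θe j i)
    (hedge : ∀ i j, G.Adj i j → α ≤ |θe i j|)
    (hnonedge : ∀ i j, ¬ G.Adj i j → θe i j = 0)
    (hM : ∀ v x, |localField θe θv v x| ≤ M)
    {u : Fin p} {S : Finset (Fin p)} (huS : u ∉ S) (hU : (G.neighborFinset u \ S).Nonempty)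
    {σ : Fin p → Bool} (hpos : 0 < prob (isingPMF G θe θv) (agree S σ))
    {W : (Fin p → Bool) → ℝ}
    (hW : ∀ x, W x = ∑ i ∈ G.neighborFinset u \ S, θe u i * spin (x i)) {w : ℝ}
    (hw : w = ∑ x, condLaw (isingPMF G θe θv) S σ x * W x) :
    exp (-(2 * M)) ^ 2 * α ^ 2
      ≤ ∑ x, condLaw (isingPMF G θe θv) S σ x * (spin (x u) * (W x - w)) := by
  set ρ := condLaw (isingPMF G θe θv) S σ with hρ
  have hρ0 : ∀ x, 0 ≤ ρ x := condLaw_nonneg (fun x => (isingPMF_pos G θe θv x).le) S σ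
  have hρ1 : ∑ x, ρ x = 1 := sum_condLaw hpos
  have huN : u ∉ G.neighborFinset u \ S := by simp
  have hWu : ∀ x, W (flipAt u x) = W x := by
    intro x
    rw [hW, hW]
    refine sum_congr rfl fun i hi => ?_
    rw [flipAt_of_ne (ne_of_mem_of_not_mem hi huN)]
  rw [sum_condLaw_spin_mul_eq_tanh G hsym hnonedge θv huS σ (fun x => by rw [hWu])]
  set c := θv u + ∑ j ∈ S, θe u j * spin (σ j) with hc
  have hfield : ∀ x, agree S σ x → localField θe θv u x = W x + c := by
    intro x hx
    have hSc : ∑ j ∈ Sᶜ, θe u j * spin (x j) = W x := by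
      rw [hW]
      refine (sum_subset (fun j hj => ?_) fun j hj hj' => ?_).symm
      · simpa using (mem_sdiff.1 hj).2
      · rw [hnonedge u j (fun h => hj' (by simpa [h] using hj)), zero_mul]
    have hS : ∑ j ∈ S, θe u j * spin (x j) = ∑ j ∈ S, θe u j * spin (σ j) :=
      sum_congr rfl fun j hj => by rw [hx j hj]
    rw [localField, ← sum_add_sum_compl S, hSc, hS, hc]
    ring
  have hsupp : ∀ x, ¬ agree S σ x → ρ x = 0 := fun x hx => by simp [hρ, condLaw, hx]
  have hcenter : ∑ x, ρ x * (W x - w) = 0 := by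
    simp only [mul_sub, sum_sub_distrib, ← sum_mul, hρ1, ← hw]
    ring
  have hwM : |w + c| ≤ M := by
    have hwc : w + c = ∑ x, ρ x * (W x + c) := by
      simp only [mul_add, sum_add_distrib, ← sum_mul, hρ1, ← hw]
      ring
    calc |w + c| ≤ ∑ x, |ρ x * (W x + c)| := hwc ▸ abs_sum_le_sum_abs _ _
      _ ≤ ∑ x, ρ x * M := by
          refine sum_le_sum fun x _ => ?_
          rw [abs_mul, abs_of_nonneg (hρ0 x)]
          by_cases hx : agree S σ x
          · exact mul_le_mul_of_nonneg_left (hfield x hx ▸ hM u x) (hρ0 x)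
          · simp [hsupp x hx]
      _ = M := by rw [← sum_mul, hρ1, one_mul]
  have hmono : exp (-(2 * M)) * ∑ x, ρ x * (W x - w) ^ 2
      ≤ ∑ x, ρ x * (tanh (localField θe θv u x) * (W x - w)) := by
    calc exp (-(2 * M)) * ∑ x, ρ x * (W x - w) ^ 2
        ≤ ∑ x, ρ x * ((tanh (localField θe θv u x) - tanh (w + c)) * (W x - w)) := by
          rw [mul_sum]
          refine sum_le_sum fun x _ => ?_
          by_cases hx : agree S σ x
          · have := mul_sub_sq_le_tanh_sub_mul_sub (hM u x) hwM
            rw [hfield x hx, add_sub_add_right_eq_sub] at this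
            rw [hfield x hx, mul_left_comm]
            exact mul_le_mul_of_nonneg_left this (hρ0 x)
          · simp [hsupp x hx]
      _ = ∑ x, ρ x * (tanh (localField θe θv u x) * (W x - w))
            - tanh (w + c) * ∑ x, ρ x * (W x - w) := by
          rw [mul_sum, ← sum_sub_distrib]
          exact sum_congr rfl fun x _ => by ring
      _ = ∑ x, ρ x * (tanh (localField θe θv u x) * (W x - w)) := by
          rw [hcenter, mul_zero, sub_zero]
  obtain ⟨k, hk⟩ := hU
  have hkS : k ∉ S := (mem_sdiff.1 hk).2
  have hku : G.Adj u k := by simpa using (mem_sdiff.1 hk).1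
  have hWk : ∀ x, W (flipAt k x) - w = W x - w - 2 * θe u k * spin (x k) := by
    intro x
    have hterm : W (flipAt k x) = W x - 2 * θe u k * spin (x k) := by
      simp only [hW, spin_flipAt, mul_sub, sum_sub_distrib, mul_ite, mul_zero, sum_ite_eq', hk,
        if_true]
      ring
    rw [hterm]
    ring
  have hvar := exp_mul_sq_le_sum_condLaw_mul_sq G hsym hnonedge θv hkS hpos (hM k)
    (f := fun x => W x - w) hWk
  have hαθ : α ^ 2 ≤ θe u k ^ 2 := by
    rw [← sq_abs (θe u k)]
    exact pow_le_pow_left₀ hα (hedge u k hku) 2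
  calc exp (-(2 * M)) ^ 2 * α ^ 2 = exp (-(2 * M)) * (exp (-(2 * M)) * α ^ 2) := by ring
    _ ≤ exp (-(2 * M)) * ∑ x, ρ x * (W x - w) ^ 2 := by
        refine mul_le_mul_of_nonneg_left (le_trans ?_ hvar) (exp_pos _).le
        exact mul_le_mul_of_nonneg_left hαθ (exp_pos _).le
    _ ≤ _ := hmono

/-- pointwise lower bound on the signed weighted influences. -/
theorem stmt5
    {p d : ℕ} (G : SimpleGraph (Fin p)) [DecidableRel G.Adj]
    (θe : Fin p → Fin p → ℝ) (θv : Fin p → ℝ) (α β h : ℝ)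
    (hα : 0 < α) (hαβ : α ≤ β) (hh : 0 ≤ h)
    (hdeg : ∀ v, G.degree v ≤ d)
    (hsym : ∀ i j, θe i j = θe j i)
    (hedge : ∀ i j, G.Adj i j → α ≤ |θe i j| ∧ |θe i j| ≤ β)
    (hnonedge : ∀ i j, ¬ G.Adj i j → θe i j = 0)
    (hfield : ∀ i, |θv i| ≤ h)
    (u : Fin p) (S : Finset (Fin p)) (huS : u ∉ S)
    (hU : (G.neighborFinset u \ S).Nonempty)
    (σ : Fin p → Bool)
    (hpos : 0 < prob (isingPMF G θe θv) (agree S σ)) :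
    ∑ i ∈ G.neighborFinset u \ S,
        θe u i * (lamWeight (isingPMF G θe θv) i S σ * condInf (isingPMF G θe θv) u i S σ)
      ≥ 2 * tauStar α β h d * ∑ i ∈ G.neighborFinset u \ S, |θe u i| := by
  set ρ := condLaw (isingPMF G θe θv) S σ with hρ
  have hβ : 0 < β := hα.trans_le hαβ
  have hd : 1 ≤ d := by
    obtain ⟨k, hk⟩ := hU
    have hcard := card_pos.2 ⟨k, (mem_sdiff.1 hk).1⟩
    rw [G.card_neighborFinset_eq_degree] at hcard
    exact hcard.trans_le (hdeg u)
  have hM : ∀ v x, |localField θe θv v x| ≤ β * d + h := fun v =>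
    abs_localField_le G hβ.le (hdeg v) (fun j hj => (hedge v j hj).2) (hnonedge v) (hfield v)
  have hcov := le_sum_condLaw_spin_mul_centered G hα.le hsym (fun i j hij => (hedge i j hij).1)
    hnonedge hM huS hU hpos (fun _ => rfl) rfl
  have hrepr : ∑ i ∈ G.neighborFinset u \ S,
        θe u i * (lamWeight (isingPMF G θe θv) i S σ * condInf (isingPMF G θe θv) u i S σ)
      = (∑ x, ρ x * (spin (x u) * (∑ i ∈ G.neighborFinset u \ S, θe u i * spin (x i)
          - ∑ y, ρ y * ∑ i ∈ G.neighborFinset u \ S, θe u i * spin (y i)))) / 2 := by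
    have hterm : ∀ i ∈ G.neighborFinset u \ S,
        θe u i * (lamWeight (isingPMF G θe θv) i S σ * condInf (isingPMF G θe θv) u i S σ)
          = ((∑ x, ρ x * (spin (x u) * (θe u i * spin (x i))))
              - (∑ x, ρ x * spin (x u)) * ∑ y, ρ y * (θe u i * spin (y i))) / 2 := by
      intro i hi
      rw [lamWeight_mul_condInf (isingPMF_pos G θe θv) hpos u (mem_sdiff.1 hi).2, ← hρ]
      simp only [mul_left_comm _ (θe u i), ← mul_sum]
      ring
    rw [sum_congr rfl hterm, ← sum_div, sum_sub_distrib, ← mul_sum, sum_comm,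
      sum_comm (s := G.neighborFinset u \ S)]
    simp only [mul_sub, sum_sub_distrib, ← mul_assoc, ← sum_mul]
    simp only [mul_assoc, ← mul_sum]
  have hθ : ∑ i ∈ G.neighborFinset u \ S, |θe u i| ≤ d * β := by
    calc ∑ i ∈ G.neighborFinset u \ S, |θe u i|
        ≤ (G.neighborFinset u \ S).card • β := sum_le_card_nsmul _ _ _ fun j hj =>
          (hedge u j (by simpa using (mem_sdiff.1 hj).1)).2
      _ ≤ d * β := by
          rw [nsmul_eq_mul]
          have hcard := (card_le_card (sdiff_subset (s := G.neighborFinset u) (t := S))).trans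
            ((G.card_neighborFinset_eq_degree u).le.trans (hdeg u))
          gcongr
  have hδ : exp (-(2 * (β * d + h))) = 2 * deltaLB β h d := by
    unfold deltaLB
    ring
  have hδ0 : 0 < deltaLB β h d := mul_pos (by norm_num) (exp_pos _)
  have hd0 : (0 : ℝ) < d := by exact_mod_cast hd
  have hτ0 : 0 ≤ tauStar α β h d := by
    unfold tauStar
    positivity
  have hτ : 2 * tauStar α β h d * (d * β) = α ^ 2 * deltaLB β h d ^ (4 * d + 1) / 8 := by
    unfold tauStar
    field_simp
    norm_num
  have hpow := mul_le_mul_of_nonneg_left (deltaLB_pow_le (d := d) hβ.le hh hd) (sq_nonneg α)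
  have hbound := mul_le_mul_of_nonneg_left hθ (mul_nonneg zero_le_two hτ0)
  have hnn : 0 ≤ α ^ 2 * deltaLB β h d ^ 2 := by positivity
  rw [hδ] at hcov
  rw [hrepr, ge_iff_le]
  linarith
end
end

section
/- For any node u ∈ V, any node i ∈ V∖{u}, and any subset S ⊆ V∖{u,i}, the conditional mutual information satisfies I(X_u ; X_i | X_S) ≥ (1/2)·ν̄(u,i,S)², equivalently √( I(X_u;X_i|X_S)/2 ) ≥ (1/2)·ν̄(u,i,S). -/
noncomputable section

open Real Finset

/-- A weak form of the Pinsker inequality, obtained through the Hellinger distance. -/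
theorem sq_sum_abs_sub_le_four_mul_kl {ι : Type*} [Fintype ι] (P Q : ι → ℝ)
    (hP : ∀ a, 0 < P a) (hQ : ∀ a, 0 < Q a) (hP1 : ∑ a, P a = 1) (hQ1 : ∑ a, Q a = 1) :
    (∑ a, |P a - Q a|) ^ 2 ≤ 4 * ∑ a, P a * Real.log (P a / Q a) := by
  have hellinger : ∑ a, (√(P a) - √(Q a)) ^ 2 ≤ ∑ a, P a * Real.log (P a / Q a) := by
    have pointwise : ∀ a, (√(P a) - √(Q a)) ^ 2 ≤ P a * Real.log (P a / Q a) + (Q a - P a) := by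
      intro a
      have hs : 0 < √(P a) := Real.sqrt_pos.2 (hP a)
      have ht : 0 < √(Q a) := Real.sqrt_pos.2 (hQ a)
      have hs2 : √(P a) ^ 2 = P a := Real.sq_sqrt (hP a).le
      have ht2 : √(Q a) ^ 2 = Q a := Real.sq_sqrt (hQ a).le
      have hlog : Real.log (P a / Q a) = -(2 * Real.log (√(Q a) / √(P a))) := by
        rw [← hs2, ← ht2, Real.sqrt_sq hs.le, Real.sqrt_sq ht.le, ← div_pow, Real.log_pow,
          ← inv_div, Real.log_inv]
        push_cast
        ring
      have hle := Real.log_le_sub_one_of_pos (div_pos ht hs)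
      have hmul : P a * (√(Q a) / √(P a)) = √(P a) * √(Q a) := by
        nth_rewrite 1 [← hs2]
        field_simp
      rw [hlog]
      nlinarith [mul_le_mul_of_nonneg_left hle (hP a).le]
    calc _ ≤ ∑ a, (P a * Real.log (P a / Q a) + (Q a - P a)) :=
          Finset.sum_le_sum fun a _ => pointwise a
      _ = _ := by
          rw [Finset.sum_add_distrib, Finset.sum_sub_distrib, hP1, hQ1]
          ring
  have hplus : ∑ a, (√(P a) + √(Q a)) ^ 2 ≤ 4 := by
    calc _ ≤ ∑ a, (2 * P a + 2 * Q a) := Finset.sum_le_sum fun a _ => by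
          nlinarith [sq_nonneg (√(P a) - √(Q a)), Real.sq_sqrt (hP a).le,
            Real.sq_sqrt (hQ a).le]
      _ = 4 := by
          rw [Finset.sum_add_distrib, ← Finset.mul_sum, ← Finset.mul_sum, hP1, hQ1]
          norm_num
  have habs : ∀ a, |P a - Q a| = |√(P a) - √(Q a)| * (√(P a) + √(Q a)) := by
    intro a
    rw [← abs_of_nonneg (add_nonneg (Real.sqrt_nonneg (P a)) (Real.sqrt_nonneg (Q a))),
      ← abs_mul]
    congr 1
    nlinarith [Real.sq_sqrt (hP a).le, Real.sq_sqrt (hQ a).le]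
  have hcs := Finset.sum_mul_sq_le_sq_mul_sq Finset.univ
    (fun a => |√(P a) - √(Q a)|) (fun a => √(P a) + √(Q a))
  simp only [sq_abs, ← habs] at hcs
  have hnonneg : 0 ≤ ∑ a, (√(P a) - √(Q a)) ^ 2 := Finset.sum_nonneg fun a _ => sq_nonneg _
  nlinarith [mul_le_mul_of_nonneg_left hplus hnonneg]

theorem prob_congr {p : ℕ} (μ : (Fin p → Bool) → ℝ) {A B : (Fin p → Bool) → Prop}
    (hAB : ∀ x, A x ↔ B x) : prob μ A = prob μ B := by
  have : A = B := funext fun x => propext (hAB x)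
  rw [this]

theorem prob_pos {p : ℕ} {μ : (Fin p → Bool) → ℝ} (hμ : ∀ x, 0 < μ x)
    {A : (Fin p → Bool) → Prop} (hA : ∃ x, A x) : 0 < prob μ A := by
  classical
  obtain ⟨x, hx⟩ := hA
  unfold prob
  refine Finset.sum_pos' (fun y _ => ?_) ⟨x, Finset.mem_univ x, ?_⟩
  · split_ifs
    exacts [(hμ y).le, le_rfl]
  · rw [if_pos hx]
    exact hμ x

/-- The law of total probability for the value of a single spin. -/
theorem prob_eq_add_spin {p : ℕ} (μ : (Fin p → Bool) → ℝ) (j : Fin p)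
    (A : (Fin p → Bool) → Prop) :
    prob μ A = prob μ (fun z => z j = true ∧ A z) + prob μ (fun z => z j = false ∧ A z) := by
  classical
  unfold prob
  rw [← Finset.sum_add_distrib]
  refine Finset.sum_congr rfl fun z _ => ?_
  by_cases hA : A z <;> cases hz : z j <;> simp [hA, hz]

theorem agree_comm {p : ℕ} {S : Finset (Fin p)} {x y : Fin p → Bool} :
    agree S x y ↔ agree S y x :=
  ⟨fun h j hj => (h j hj).symm, fun h j hj => (h j hj).symm⟩

theorem agree_iff_of_agree {p : ℕ} {S : Finset (Fin p)} {x y : Fin p → Bool}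
    (hxy : agree S x y) (z : Fin p → Bool) : agree S y z ↔ agree S x z :=
  ⟨fun h j hj => (h j hj).trans (hxy j hj), fun h j hj => (h j hj).trans (hxy j hj).symm⟩

/-- The tower property: averaging the conditional expectation given `X_S` yields the
expectation. -/
theorem sum_mul_condExp_agree {p : ℕ} {μ : (Fin p → Bool) → ℝ} (hμ : ∀ x, 0 < μ x)
    (S : Finset (Fin p)) (f : (Fin p → Bool) → ℝ) :
    ∑ x, μ x * condExp μ (agree S x) f = ∑ x, μ x * f x := by
  classical
  unfold condExp
  simp only [Finset.sum_div, Finset.mul_sum]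
  rw [Finset.sum_comm]
  refine Finset.sum_congr rfl fun y _ => ?_
  have hn : prob μ (agree S y) ≠ 0 := (prob_pos hμ ⟨y, fun _ _ => rfl⟩).ne'
  have hterm : ∀ x, μ x * ((if agree S x y then μ y * f y else 0) / prob μ (agree S x))
      = (if agree S y x then μ x else 0) * (μ y * f y / prob μ (agree S y)) := by
    intro x
    by_cases hxy : agree S x y
    · rw [if_pos hxy, if_pos (agree_comm.1 hxy), prob_congr μ (agree_iff_of_agree hxy)]
    · rw [if_neg hxy, if_neg fun h => hxy (agree_comm.1 h)]
      simp
  rw [Finset.sum_congr rfl fun x _ => hterm x, ← Finset.sum_mul]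
  change prob μ (agree S y) * _ = _
  field_simp

/-- Conditional expectation given `X_S` of a function of the spins at `u` and `i`. -/
theorem condExp_agree_eq_sum {p : ℕ} (μ : (Fin p → Bool) → ℝ) (u i : Fin p)
    (S : Finset (Fin p)) (x : Fin p → Bool) (f : (Fin p → Bool) → ℝ) (g : Bool × Bool → ℝ)
    (hfg : ∀ y, agree S x y → f y = g (y u, y i)) :
    condExp μ (agree S x) f = ∑ c : Bool × Bool,
      prob μ (fun z => z u = c.1 ∧ z i = c.2 ∧ agree S x z) / prob μ (agree S x) * g c := by
  classical
  simp only [div_mul_eq_mul_div]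
  rw [← Finset.sum_div]
  unfold condExp
  congr 1
  simp only [prob, Finset.sum_mul]
  rw [Finset.sum_comm]
  refine Finset.sum_congr rfl fun y _ => ?_
  by_cases hy : agree S x y
  · rw [if_pos hy, hfg y hy, Finset.sum_eq_single (y u, y i)]
    · simp [hy]
    · rintro ⟨a, b⟩ - hne
      rw [if_neg, zero_mul]
      rintro ⟨ha, hb, -⟩
      exact hne (by rw [ha, hb])
    · simp
  · simp [hy]

/-- Weak Pinsker inequality for a strictly positive 2 × 2 contingency table against the product
of its marginals. -/
theorem sq_le_mutualInfo_table (k : Bool × Bool → ℝ) (hk : ∀ c, 0 < k c) (n : ℝ)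
    (row col : Bool → ℝ) (hrow : ∀ a, row a = k (a, true) + k (a, false))
    (hcol : ∀ b, col b = k (true, b) + k (false, b)) (hn : n = col true + col false) :
    (2 * (col true / n) * (col false / n)
        * |k (true, true) / col true - k (true, false) / col false|) ^ 2
      ≤ ∑ c, k c / n * Real.log (k c * n / (row c.1 * col c.2)) := by
  have hr : ∀ a, 0 < row a := fun a => by rw [hrow]; exact add_pos (hk _) (hk _)
  have hc : ∀ b, 0 < col b := fun b => by rw [hcol]; exact add_pos (hk _) (hk _)
  have hn0 : 0 < n := by rw [hn]; exact add_pos (hc _) (hc _)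
  have hne := hn0.ne'
  have hpinsker := sq_sum_abs_sub_le_four_mul_kl (fun c : Bool × Bool => k c / n)
    (fun c => row c.1 * col c.2 / n ^ 2) (fun c => div_pos (hk c) hn0)
    (fun c => div_pos (mul_pos (hr _) (hc _)) (pow_pos hn0 2))
    (by
      rw [← Finset.sum_div, div_eq_one_iff_eq hne, Fintype.sum_prod_type]
      simp only [Fintype.sum_bool, hn, hcol]
      ring)
    (by
      rw [← Finset.sum_div, div_eq_one_iff_eq (pow_ne_zero 2 hne), Fintype.sum_prod_type]
      simp only [Fintype.sum_bool, hn, hcol, hrow]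
      ring)
  have hlog : ∀ c : Bool × Bool, k c / n / (row c.1 * col c.2 / n ^ 2)
      = k c * n / (row c.1 * col c.2) := by
    intro c
    have h1 := (hr c.1).ne'
    have h2 := (hc c.2).ne'
    field_simp
  simp only [hlog] at hpinsker
  set D := k (true, true) * k (false, false) - k (true, false) * k (false, true) with hD
  have hdiff : ∀ c : Bool × Bool, |k c / n - row c.1 * col c.2 / n ^ 2| = |D| / n ^ 2 := by
    have hsub : ∀ c : Bool × Bool, k c / n - row c.1 * col c.2 / n ^ 2
        = (k c * n - row c.1 * col c.2) / n ^ 2 := by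
      intro c
      field_simp
    intro c
    rw [hsub, abs_div, abs_of_pos (pow_pos hn0 2)]
    congr 1
    rcases c with ⟨_ | _, _ | _⟩
    · congr 1
      simp only [hD, hn, hcol, hrow]
      ring
    · rw [← abs_neg]
      congr 1
      simp only [hD, hn, hcol, hrow]
      ring
    · rw [← abs_neg]
      congr 1
      simp only [hD, hn, hcol, hrow]
      ring
    · congr 1
      simp only [hD, hn, hcol, hrow]
      ring
  have hinf : k (true, true) / col true - k (true, false) / col false
      = D / (col true * col false) := by
    rw [div_sub_div _ _ (hc true).ne' (hc false).ne']
    congr 1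
    simp only [hD, hcol]
    ring
  have hleft : 2 * (col true / n) * (col false / n)
      * |k (true, true) / col true - k (true, false) / col false| = 2 * (|D| / n ^ 2) := by
    rw [hinf, abs_div, abs_of_pos (mul_pos (hc true) (hc false))]
    have h1 := (hc true).ne'
    have h2 := (hc false).ne'
    field_simp
  rw [hleft]
  simp only [hdiff, Finset.sum_const, Finset.card_univ, Fintype.card_prod, Fintype.card_bool,
    nsmul_eq_mul] at hpinsker
  push_cast at hpinsker
  nlinarith

theorem exists_spins_agree {p : ℕ} {u i : Fin p} (hui : u ≠ i) {S : Finset (Fin p)}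
    (huS : u ∉ S) (hiS : i ∉ S) (x : Fin p → Bool) (a b : Bool) :
    ∃ z : Fin p → Bool, z u = a ∧ z i = b ∧ agree S x z := by
  refine ⟨Function.update (Function.update x u a) i b, ?_, ?_, fun j hj => ?_⟩
  · rw [Function.update_of_ne hui, Function.update_self]
  · rw [Function.update_self]
  · rw [Function.update_of_ne (ne_of_mem_of_not_mem hj hiS),
      Function.update_of_ne (ne_of_mem_of_not_mem hj huS)]

/-- For a strictly positive distribution, the conditional mutual information dominates the
square of the average conditional influence. -/
theorem sq_avgInf_le_condMI {p : ℕ} {μ : (Fin p → Bool) → ℝ} (hμ : ∀ x, 0 < μ x)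
    (hμ1 : ∑ x, μ x = 1) {u i : Fin p} (hui : u ≠ i) {S : Finset (Fin p)} (huS : u ∉ S)
    (hiS : i ∉ S) : avgInf μ u i S ^ 2 ≤ condMI μ u i S := by
  have hpoint : ∀ x, (lamWeight μ i S x * |condInf μ u i S x|) ^ 2 ≤
      condExp μ (agree S x) (fun y => Real.log
        ((prob μ (fun z => z u = y u ∧ z i = y i ∧ agree S y z) * prob μ (agree S y))
          / (prob μ (fun z => z u = y u ∧ agree S y z)
              * prob μ (fun z => z i = y i ∧ agree S y z)))) := by
    intro x
    have htable := sq_le_mutualInfo_table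
      (fun c => prob μ (fun z => z u = c.1 ∧ z i = c.2 ∧ agree S x z))
      (fun c => prob_pos hμ (exists_spins_agree hui huS hiS x c.1 c.2))
      (prob μ (agree S x))
      (fun a => prob μ (fun z => z u = a ∧ agree S x z))
      (fun b => prob μ (fun z => z i = b ∧ agree S x z))
      (fun a => by
        rw [prob_eq_add_spin μ i]
        congr 1 <;> exact prob_congr μ fun z => and_left_comm)
      (fun b => prob_eq_add_spin μ u _)
      (prob_eq_add_spin μ i _)
    rw [condExp_agree_eq_sum μ u i S x _ (fun c => Real.log
      ((prob μ (fun z => z u = c.1 ∧ z i = c.2 ∧ agree S x z) * prob μ (agree S x))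
        / (prob μ (fun z => z u = c.1 ∧ agree S x z)
            * prob μ (fun z => z i = c.2 ∧ agree S x z))))
      (fun y hy => by simp only [agree_iff_of_agree hy, prob_congr μ (agree_iff_of_agree hy)])]
    exact htable
  have hmean : ∑ x, μ x * (lamWeight μ i S x * |condInf μ u i S x|) ^ 2 ≤ condMI μ u i S :=
    (Finset.sum_le_sum fun x _ => mul_le_mul_of_nonneg_left (hpoint x) (hμ x).le).trans
      (sum_mul_condExp_agree hμ S _).le
  refine le_trans ?_ hmean
  exact (even_two.convexOn_pow (𝕜 := ℝ)).map_sum_le (t := Finset.univ) (w := μ)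
    (p := fun x => lamWeight μ i S x * |condInf μ u i S x|)
    (fun x _ => (hμ x).le) hμ1 (fun _ _ => Set.mem_univ _)

theorem sum_isingPMF {p : ℕ} (G : SimpleGraph (Fin p)) [DecidableRel G.Adj]
    (θe : Fin p → Fin p → ℝ) (θv : Fin p → ℝ) : ∑ x, isingPMF G θe θv x = 1 := by
  unfold isingPMF
  rw [← Finset.sum_div]
  exact div_self
    (Finset.sum_pos (fun _ _ => Real.exp_pos _) Finset.univ_nonempty).ne'

/-- the conditional mutual information dominates half the squared average
conditional influence. -/
theorem stmt12
    {p d : ℕ} (G : SimpleGraph (Fin p)) [DecidableRel G.Adj]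
    (θe : Fin p → Fin p → ℝ) (θv : Fin p → ℝ) (α β h : ℝ)
    (hα : 0 < α) (hαβ : α ≤ β) (hh : 0 ≤ h)
    (hdeg : ∀ v, G.degree v ≤ d)
    (hsym : ∀ i j, θe i j = θe j i)
    (hedge : ∀ i j, G.Adj i j → α ≤ |θe i j| ∧ |θe i j| ≤ β)
    (hnonedge : ∀ i j, ¬ G.Adj i j → θe i j = 0)
    (hfield : ∀ i, |θv i| ≤ h)
    (u i : Fin p) (hui : u ≠ i) (S : Finset (Fin p)) (huS : u ∉ S) (hiS : i ∉ S) :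
    condMI (isingPMF G θe θv) u i S ≥ (1/2) * (avgInf (isingPMF G θe θv) u i S) ^ 2
    ∧ Real.sqrt (condMI (isingPMF G θe θv) u i S / 2)
        ≥ (1/2) * avgInf (isingPMF G θe θv) u i S := by
  have hsq := sq_avgInf_le_condMI (isingPMF_pos G θe θv) (sum_isingPMF G θe θv) hui huS hiS
  have hMI : (1/2) * (avgInf (isingPMF G θe θv) u i S) ^ 2
      ≤ condMI (isingPMF G θe θv) u i S := by
    nlinarith [sq_nonneg (avgInf (isingPMF G θe θv) u i S)]
  refine ⟨hMI, Real.le_sqrt_of_sq_le ?_⟩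
  nlinarith
end
end
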